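/- arXiv:1903.04287 — 2 statements merged into one kernel-verified Lean document; each statement's English description precedes it below -/
import Mathlib

section
/- There are exactly q+1 cyclic submodules of ²T(q) of cardinality q², and each of them is contained in some free cyclic submodule of ²T(q) generated by a non-unimodular pair. -/
open Matrix

/-- `Mat n F` is the type of `n × n` matrices over `F`. -/
abbrev Mat (n : ℕ) (F : Type) : Type := Matrix (Fin n) (Fin n) F

/-- A matrix is lower triangular (i.e. belongs to the ring `T_n(q)`)
if all entries above the diagonal vanish. -/
def LowerTri {n : ℕ} {F : Type} [Zero F] (X : Mat n F) : Prop :=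
  ∀ i j : Fin n, i < j → X i j = 0

/-- The cyclic left submodule `T_n(q)(X,Y)` of `²T_n(q)` generated by the pair `(X,Y)`. -/
def cyc {n : ℕ} {F : Type} [Field F] (X Y : Mat n F) : Set (Mat n F × Mat n F) :=
  {p | ∃ A : Mat n F, LowerTri A ∧ p = (A * X, A * Y)}

/-- The pair `(X,Y)` generates a *free* cyclic submodule:
`A • (X,Y) = (0,0)` with `A ∈ T_n(q)` forces `A = 0`. -/
def IsFreePair {n : ℕ} {F : Type} [Field F] (X Y : Mat n F) : Prop :=
  ∀ A : Mat n F, LowerTri A → A * X = 0 → A * Y = 0 → A = 0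

/-- A pair `(X,Y)` is unimodular if for every index `i` one of the `i`-th
diagonal entries of `X`, `Y` is nonzero. -/
def Unimodular {n : ℕ} {F : Type} [Field F] (X Y : Mat n F) : Prop :=
  ∀ i : Fin n, X i i ≠ 0 ∨ Y i i ≠ 0

/-- `M` is a free cyclic submodule of `²T_n(q)`. -/
def IsFreeCyc {n : ℕ} {F : Type} [Field F] (M : Set (Mat n F × Mat n F)) : Prop :=
  ∃ X Y : Mat n F, LowerTri X ∧ LowerTri Y ∧ IsFreePair X Y ∧ M = cyc X Y

/-- `M` is a free cyclic submodule of `²T_n(q)` generated by a non-unimodular pair. -/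
def IsNonUnimodFreeCyc {n : ℕ} {F : Type} [Field F] (M : Set (Mat n F × Mat n F)) : Prop :=
  ∃ X Y : Mat n F, LowerTri X ∧ LowerTri Y ∧ ¬ Unimodular X Y ∧ IsFreePair X Y ∧ M = cyc X Y

/-- The pair of matrices generated from `!![s, 0; 0, 0]` and `!![t, 0; 0, 0]` by
`!![a, 0; b, *]`. -/
def linePair {F : Type} [Field F] (s t : F) (p : F × F) : Mat 2 F × Mat 2 F :=
  (!![p.1 * s, 0; p.2 * s, 0], !![p.1 * t, 0; p.2 * t, 0])

/-- The cyclic submodule attached to the line spanned by `(s, t)`. -/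
def lineSubmodule {F : Type} [Field F] (s t : F) : Set (Mat 2 F × Mat 2 F) :=
  Set.range (linePair s t)

/-- The general element of `cyc !![s, 0; x, z] !![t, 0; y, w]`. -/
def cycElem {F : Type} [Field F] (s x z t y w : F) (p : F × F × F) : Mat 2 F × Mat 2 F :=
  (!![p.1 * s, 0; p.2.1 * s + p.2.2 * x, p.2.2 * z],
    !![p.1 * t, 0; p.2.1 * t + p.2.2 * y, p.2.2 * w])

theorem matrix_two_inj {R : Type*} {a b c d a' b' c' d' : R} :
    !![a, b; c, d] = !![a', b'; c', d'] ↔ a = a' ∧ b = b' ∧ c = c' ∧ d = d' := by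
  simp [and_assoc]

section

variable {F : Type} [Field F]

theorem lowerTri_of (s x z : F) : LowerTri !![s, 0; x, z] := by
  intro i j h
  fin_cases i <;> fin_cases j <;> simp_all

theorem LowerTri.eq_of {X : Mat 2 F} (h : LowerTri X) : X = !![X 0 0, 0; X 1 0, X 1 1] := by
  rw [← h 0 1 (by decide)]
  exact Matrix.eta_fin_two X

theorem cyc_eq_range (s x z t y w : F) :
    cyc !![s, 0; x, z] !![t, 0; y, w] = Set.range (cycElem s x z t y w) := by
  ext p
  constructor
  · rintro ⟨A, hA, rfl⟩
    refine ⟨(A 0 0, A 1 0, A 1 1), ?_⟩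
    rw [hA.eq_of]
    simp [cycElem]
  · rintro ⟨⟨a, c, d⟩, rfl⟩
    exact ⟨!![a, 0; c, d], lowerTri_of a c d, by simp [cycElem]⟩

theorem lineSubmodule_eq_cyc (s t : F) :
    lineSubmodule s t = cyc !![s, 0; 0, 0] !![t, 0; 0, 0] := by
  rw [cyc_eq_range]
  ext p
  constructor
  · rintro ⟨⟨a, b⟩, rfl⟩
    exact ⟨(a, b, 0), by simp [cycElem, linePair]⟩
  · rintro ⟨⟨a, b, d⟩, rfl⟩
    exact ⟨(a, b), by simp [cycElem, linePair]⟩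

theorem linePair_injective {s t : F} (h : s ≠ 0 ∨ t ≠ 0) : Function.Injective (linePair s t) := by
  rintro ⟨a, b⟩ ⟨a', b'⟩ e
  rw [linePair, linePair, Prod.mk.injEq, matrix_two_inj, matrix_two_inj] at e
  obtain ⟨⟨h1, -, h2, -⟩, h3, -, h4, -⟩ := e
  rcases h with hs | ht
  · exact Prod.ext (mul_right_cancel₀ hs h1) (mul_right_cancel₀ hs h2)
  · exact Prod.ext (mul_right_cancel₀ ht h3) (mul_right_cancel₀ ht h4)

theorem cycElem_injective {s x z t y w : F} (h : s ≠ 0 ∨ t ≠ 0)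
    (h' : z ≠ 0 ∨ w ≠ 0 ∨ s * y ≠ t * x) : Function.Injective (cycElem s x z t y w) := by
  rintro ⟨a, c, d⟩ ⟨a', c', d'⟩ e
  rw [cycElem, cycElem, Prod.mk.injEq, matrix_two_inj, matrix_two_inj] at e
  obtain ⟨⟨h1, -, h2, h3⟩, h4, -, h5, h6⟩ := e
  have hd : d = d' := by
    rcases h' with hz | hw | hdet
    · exact mul_right_cancel₀ hz h3
    · exact mul_right_cancel₀ hw h6
    · exact mul_right_cancel₀ (sub_ne_zero.2 hdet) (by linear_combination s * h5 - t * h2)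
  subst hd
  rcases h with hs | ht
  · rw [Prod.ext_iff, Prod.ext_iff]
    exact ⟨mul_right_cancel₀ hs h1, mul_right_cancel₀ hs (add_right_cancel h2), rfl⟩
  · rw [Prod.ext_iff, Prod.ext_iff]
    exact ⟨mul_right_cancel₀ ht h4, mul_right_cancel₀ ht (add_right_cancel h5), rfl⟩

theorem lineSubmodule_smul {k : F} (hk : k ≠ 0) (s t : F) :
    lineSubmodule (k * s) (k * t) = lineSubmodule s t := by
  ext p
  constructor
  · rintro ⟨⟨a, b⟩, rfl⟩
    exact ⟨(a * k, b * k), by simp [linePair, mul_assoc]⟩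
  · rintro ⟨⟨a, b⟩, rfl⟩
    exact ⟨(a * k⁻¹, b * k⁻¹), by simp [linePair, mul_assoc, hk]⟩

theorem cyc_eq_lineSubmodule {s x t y : F} (h : s ≠ 0 ∨ t ≠ 0) (hdet : s * y = t * x) :
    cyc !![s, 0; x, 0] !![t, 0; y, 0] = lineSubmodule s t := by
  obtain ⟨k, rfl, rfl⟩ : ∃ k, x = k * s ∧ y = k * t := by
    rcases h with hs | ht
    · exact ⟨x / s, by field_simp, by field_simp; linear_combination hdet⟩
    · exact ⟨y / t, by field_simp; linear_combination -hdet, by field_simp⟩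
  rw [cyc_eq_range]
  ext p
  constructor
  · rintro ⟨⟨a, c, d⟩, rfl⟩
    exact ⟨(a, c + d * k), by simp [cycElem, linePair, add_mul, mul_assoc]⟩
  · rintro ⟨⟨a, b⟩, rfl⟩
    exact ⟨(a, b, 0), by simp [cycElem, linePair]⟩

theorem ncard_lineSubmodule [Fintype F] {s t : F} (h : s ≠ 0 ∨ t ≠ 0) :
    (lineSubmodule s t).ncard = Fintype.card F ^ 2 := by
  rw [lineSubmodule, Set.ncard_range_of_injective (linePair_injective h)]
  simp [sq]

/-- The cyclic submodules of cardinality `|F|²` are exactly those attached to lines. -/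
theorem cyclic_ncard_eq_sq_iff [Fintype F] (M : Set (Mat 2 F × Mat 2 F)) :
    ((∃ X Y : Mat 2 F, LowerTri X ∧ LowerTri Y ∧ M = cyc X Y) ∧
      M.ncard = Fintype.card F ^ 2) ↔
    ∃ s t : F, (s ≠ 0 ∨ t ≠ 0) ∧ M = lineSubmodule s t := by
  have hq : 1 < Fintype.card F := Fintype.one_lt_card
  constructor
  · rintro ⟨⟨X, Y, hX, hY, rfl⟩, hM⟩
    rw [hX.eq_of, hY.eq_of] at hM ⊢
    generalize X 0 0 = s, X 1 0 = x, X 1 1 = z, Y 0 0 = t, Y 1 0 = y, Y 1 1 = w at hM ⊢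
    by_cases h : s ≠ 0 ∨ t ≠ 0
    · by_cases h' : z ≠ 0 ∨ w ≠ 0 ∨ s * y ≠ t * x
      · rw [cyc_eq_range, Set.ncard_range_of_injective (cycElem_injective h h')] at hM
        have : Fintype.card F ^ 3 = Fintype.card F ^ 2 := by
          rw [← hM]; simp [pow_succ, mul_assoc]
        exact absurd (Nat.pow_right_injective hq this) (by decide)
      · push Not at h'
        obtain ⟨rfl, rfl, hdet⟩ := h'
        exact ⟨s, t, h, cyc_eq_lineSubmodule h hdet⟩
    · push Not at h
      obtain ⟨rfl, rfl⟩ := h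
      have hsub : cyc !![0, 0; x, z] !![0, 0; y, w] ⊆
          (fun d : F => cycElem 0 x z 0 y w (0, 0, d)) '' Set.univ := by
        rw [cyc_eq_range]
        rintro _ ⟨⟨a, c, d⟩, rfl⟩
        exact ⟨d, trivial, by simp [cycElem]⟩
      have hle := (Set.ncard_le_ncard hsub (Set.toFinite _)).trans
        (Set.ncard_image_le Set.finite_univ)
      rw [hM, Set.ncard_univ, Nat.card_eq_fintype_card] at hle
      nlinarith
  · rintro ⟨s, t, h, rfl⟩
    exact ⟨⟨_, _, lowerTri_of _ _ _, lowerTri_of _ _ _, lineSubmodule_eq_cyc s t⟩,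
      ncard_lineSubmodule h⟩

/-- The submodules attached to the points of the projective line `F ∪ {∞}`. -/
def pointSubmodule : Option F → Set (Mat 2 F × Mat 2 F)
  | none => lineSubmodule 0 1
  | some t => lineSubmodule 1 t

theorem range_pointSubmodule :
    Set.range (pointSubmodule (F := F)) =
      {M | ∃ s t : F, (s ≠ 0 ∨ t ≠ 0) ∧ M = lineSubmodule s t} := by
  ext M
  constructor
  · rintro ⟨_ | t, rfl⟩
    · exact ⟨0, 1, by simp, rfl⟩
    · exact ⟨1, t, by simp, rfl⟩
  · rintro ⟨s, t, h, rfl⟩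
    by_cases hs : s = 0
    · subst hs
      have ht : t ≠ 0 := by simpa using h
      exact ⟨none, by simpa [pointSubmodule] using (lineSubmodule_smul ht 0 1).symm⟩
    · exact ⟨some (t / s), by
        simpa [pointSubmodule, mul_div_cancel₀, hs] using (lineSubmodule_smul hs 1 (t / s)).symm⟩

theorem mul_eq_mul_of_lineSubmodule_eq {s t s' t' : F}
    (h : lineSubmodule s t = lineSubmodule s' t') : s * t' = t * s' := by
  have hmem : linePair s t (1, 0) ∈ lineSubmodule s' t' := h ▸ Set.mem_range_self _
  obtain ⟨⟨a, b⟩, e⟩ := hmem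
  simp [linePair] at e
  obtain ⟨⟨rfl, -⟩, rfl, -⟩ := e
  ring

theorem pointSubmodule_injective : Function.Injective (pointSubmodule (F := F)) := by
  rintro (_ | t) (_ | t') h <;> have := mul_eq_mul_of_lineSubmodule_eq h <;> simp_all

theorem lineSubmodule_subset_nonUnimodFreeCyc {s t : F} (h : s ≠ 0 ∨ t ≠ 0) :
    ∃ N : Set (Mat 2 F × Mat 2 F), IsNonUnimodFreeCyc N ∧ lineSubmodule s t ⊆ N := by
  obtain ⟨x, y, hdet⟩ : ∃ x y : F, s * y ≠ t * x := by
    rcases h with hs | ht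
    · exact ⟨0, 1, by simpa using hs⟩
    · exact ⟨1, 0, by simpa using ht.symm⟩
  refine ⟨_, ⟨!![s, 0; x, 0], !![t, 0; y, 0], lowerTri_of _ _ _, lowerTri_of _ _ _,
    fun hU => by simpa using hU 1, fun A hA hX hY => ?_, rfl⟩, ?_⟩
  · rw [hA.eq_of] at hX hY ⊢
    have e : cycElem s x 0 t y 0 (A 0 0, A 1 0, A 1 1) = cycElem s x 0 t y 0 (0, 0, 0) := by
      refine Eq.trans (b := (0, 0)) (Eq.trans ?_ (congrArg₂ Prod.mk hX hY)) ?_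
      · simp [cycElem]
      · ext i j <;> fin_cases i <;> fin_cases j <;> simp [cycElem]
    have e' := cycElem_injective h (.inr (.inr hdet)) e
    simp only [Prod.mk.injEq] at e'
    ext i j
    fin_cases i <;> fin_cases j <;> simp [e']
  · rw [cyc_eq_range]
    rintro _ ⟨⟨a, b⟩, rfl⟩
    exact ⟨(a, b, 0), by simp [cycElem, linePair]⟩

end

theorem stmt_7 (q : ℕ) (hq : 2 ≤ q)
    (F : Type) [Field F] [Fintype F] (hF : Fintype.card F = q) :
    Set.ncard {M : Set (Mat 2 F × Mat 2 F) |
        (∃ X Y : Mat 2 F, LowerTri X ∧ LowerTri Y ∧ M = cyc X Y) ∧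
        Set.ncard M = q ^ 2}
      = q + 1 ∧
    ∀ M : Set (Mat 2 F × Mat 2 F),
      (∃ X Y : Mat 2 F, LowerTri X ∧ LowerTri Y ∧ M = cyc X Y) →
      Set.ncard M = q ^ 2 →
      ∃ N : Set (Mat 2 F × Mat 2 F), IsNonUnimodFreeCyc N ∧ M ⊆ N := by
  subst hF
  constructor
  · simp_rw [cyclic_ncard_eq_sq_iff]
    rw [← range_pointSubmodule, Set.ncard_range_of_injective pointSubmodule_injective]
    simp
  · intro M hM hcard
    obtain ⟨s, t, h, rfl⟩ := (cyclic_ncard_eq_sq_iff M).1 ⟨hM, hcard⟩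
    exact lineSubmodule_subset_nonUnimodFreeCyc h
end

section
/- There are exactly (q+1)²·(2q²+q+1) free cyclic submodules of ²T₃(q) generated by non-unimodular pairs. -/
open Matrix

/-! ### Counting along fibres -/

theorem ncard_eq_ncard_image_mul {α β : Type*} [Finite α] (f : α → β) (s : Set α) (m : ℕ)
    (h : ∀ a ∈ s, {x | x ∈ s ∧ f x = f a}.ncard = m) : s.ncard = (f '' s).ncard * m := by
  classical
  have := Fintype.ofFinite α
  rw [Set.ncard_eq_toFinset_card' s, Set.ncard_eq_toFinset_card' (f '' s), Set.toFinset_image,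
    Finset.card_eq_sum_card_image f s.toFinset, Finset.sum_const_nat]
  intro b hb
  obtain ⟨a, ha, rfl⟩ := Finset.mem_image.1 hb
  rw [← h a (by simpa using ha), Set.ncard_eq_toFinset_card']
  congr 1
  ext x
  simp

theorem ncard_fibred {α β : Type*} [Finite α] [Finite β] (t : Set α) (u : α → Set β) (m : ℕ)
    (h : ∀ a ∈ t, (u a).ncard = m) :
    {p : α × β | p.1 ∈ t ∧ p.2 ∈ u p.1}.ncard = t.ncard * m := by
  classical
  have := Fintype.ofFinite α
  have := Fintype.ofFinite β
  have e : {p : α × β | p.1 ∈ t ∧ p.2 ∈ u p.1}.toFinset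
      = (t.toFinset.sigma fun a => (u a).toFinset).map
        (Equiv.sigmaEquivProd α β).toEmbedding := by
    ext ⟨a, b⟩
    simp
  rw [Set.ncard_eq_toFinset_card' t, Set.ncard_eq_toFinset_card', e, Finset.card_map,
    Finset.card_sigma, Finset.sum_const_nat]
  intro a ha
  rw [← h a (by simpa using ha), Set.ncard_eq_toFinset_card']

/-! ### Lower triangular matrices and cyclic submodules -/

section LowerTri

variable {n : ℕ} {F : Type} [Field F] {A B X Y : Mat n F}

theorem LowerTri.mul (hA : LowerTri A) (hB : LowerTri B) : LowerTri (A * B) :=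
  Matrix.BlockTriangular.mul (b := OrderDual.toDual) hA hB

theorem LowerTri.one : LowerTri (1 : Mat n F) :=
  Matrix.blockTriangular_one (b := OrderDual.toDual)

theorem LowerTri.det (hA : LowerTri A) : A.det = ∏ i, A i i :=
  Matrix.det_of_isLowerTriangular A hA

theorem LowerTri.mul_diag (hA : LowerTri A) (hX : LowerTri X) (i : Fin n) :
    (A * X) i i = A i i * X i i := by
  rw [Matrix.mul_apply, Finset.sum_eq_single i]
  · intro j _ hj
    rcases lt_or_gt_of_ne hj with h | h
    · rw [hX j i h, mul_zero]
    · rw [hA i j h, zero_mul]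
  · simp

theorem LowerTri.inv (hA : LowerTri A) (h : IsUnit A.det) : LowerTri A⁻¹ := by
  have := Matrix.invertibleOfIsUnitDet A h
  exact Matrix.blockTriangular_inv_of_blockTriangular (b := OrderDual.toDual) hA

/-- The unit group of `T_n(q)`, as a set of matrices. -/
def lowerUnits (n : ℕ) (F : Type) [Field F] : Set (Mat n F) :=
  {A | LowerTri A ∧ ∀ i, A i i ≠ 0}

theorem isUnit_det_of_mem_lowerUnits (hA : A ∈ lowerUnits n F) : IsUnit A.det := by
  rw [hA.1.det, isUnit_iff_ne_zero]
  exact Finset.prod_ne_zero_iff.2 fun i _ => hA.2 i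

theorem mem_cyc_self : (X, Y) ∈ cyc X Y :=
  ⟨1, LowerTri.one, by simp⟩

theorem cyc_mul_subset (hA : LowerTri A) : cyc (A * X) (A * Y) ⊆ cyc X Y := by
  rintro _ ⟨B, hB, rfl⟩
  exact ⟨B * A, hB.mul hA, by simp [Matrix.mul_assoc]⟩

theorem cyc_mul (hA : A ∈ lowerUnits n F) : cyc (A * X) (A * Y) = cyc X Y := by
  have hu := isUnit_det_of_mem_lowerUnits hA
  refine (cyc_mul_subset hA.1).antisymm ?_
  have := cyc_mul_subset (X := A * X) (Y := A * Y) (hA.1.inv hu)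
  rwa [Matrix.nonsing_inv_mul_cancel_left _ _ hu, Matrix.nonsing_inv_mul_cancel_left _ _ hu] at this

/-- The pairs of lower triangular matrices that are free and non-unimodular. -/
def nonUnimodFreePairs (n : ℕ) (F : Type) [Field F] : Set (Mat n F × Mat n F) :=
  {p | LowerTri p.1 ∧ LowerTri p.2 ∧ ¬ Unimodular p.1 p.2 ∧ IsFreePair p.1 p.2}

theorem setOf_isNonUnimodFreeCyc :
    {M : Set (Mat n F × Mat n F) | IsNonUnimodFreeCyc M}
      = (fun p => cyc p.1 p.2) '' nonUnimodFreePairs n F := by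
  ext M
  constructor
  · rintro ⟨X, Y, hX, hY, hu, hf, rfl⟩
    exact ⟨(X, Y), ⟨hX, hY, hu, hf⟩, rfl⟩
  · rintro ⟨⟨X, Y⟩, ⟨hX, hY, hu, hf⟩, rfl⟩
    exact ⟨X, Y, hX, hY, hu, hf, rfl⟩

theorem IsFreePair.eq_of_mul_eq (h : IsFreePair X Y) (hA : LowerTri A) (hB : LowerTri B)
    (hX : A * X = B * X) (hY : A * Y = B * Y) : A = B := by
  refine sub_eq_zero.1 (h (A - B) (fun i j hij => ?_) ?_ ?_)
  · simp [hA i j hij, hB i j hij]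
  · rw [Matrix.sub_mul, hX, sub_self]
  · rw [Matrix.sub_mul, hY, sub_self]

theorem mul_mem_nonUnimodFreePairs (h : (X, Y) ∈ nonUnimodFreePairs n F)
    (hA : A ∈ lowerUnits n F) : (A * X, A * Y) ∈ nonUnimodFreePairs n F := by
  obtain ⟨hX, hY, hu, hf⟩ := h
  refine ⟨hA.1.mul hX, hA.1.mul hY, fun h => hu fun i => ?_, fun B hB hBX hBY => ?_⟩
  · have := h i
    simpa [hA.1.mul_diag hX, hA.1.mul_diag hY, hA.2 i] using this
  · have := hf (B * A) (hB.mul hA.1) (by rw [Matrix.mul_assoc]; exact hBX)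
      (by rw [Matrix.mul_assoc]; exact hBY)
    have hi := congrArg (· * A⁻¹) this
    simpa [Matrix.mul_nonsing_inv_cancel_right _ _ (isUnit_det_of_mem_lowerUnits hA)] using hi

theorem cyc_fibre (h : (X, Y) ∈ nonUnimodFreePairs n F) :
    {p | p ∈ nonUnimodFreePairs n F ∧ cyc p.1 p.2 = cyc X Y}
      = (fun A => (A * X, A * Y)) '' lowerUnits n F := by
  ext p
  constructor
  · rintro ⟨-, hc⟩
    obtain ⟨A, hA, hp⟩ : p ∈ cyc X Y := hc ▸ mem_cyc_self
    obtain ⟨B, hB, hXY⟩ : (X, Y) ∈ cyc p.1 p.2 := hc ▸ mem_cyc_self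
    subst hp
    obtain ⟨h1, h2⟩ := Prod.mk.inj hXY
    have hBA : B * A = 1 := h.2.2.2.eq_of_mul_eq (hB.mul hA) LowerTri.one
      (by rw [Matrix.mul_assoc, Matrix.one_mul]; exact h1.symm)
      (by rw [Matrix.mul_assoc, Matrix.one_mul]; exact h2.symm)
    refine ⟨A, ⟨hA, fun i hi => ?_⟩, rfl⟩
    have := hB.mul_diag hA i
    simp [hBA, hi] at this
  · rintro ⟨A, hA, rfl⟩
    exact ⟨mul_mem_nonUnimodFreePairs h hA, cyc_mul hA⟩

theorem ncard_nonUnimodFreePairs [Finite F] :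
    (nonUnimodFreePairs n F).ncard
      = {M : Set (Mat n F × Mat n F) | IsNonUnimodFreeCyc M}.ncard * (lowerUnits n F).ncard := by
  have : Finite (Mat n F × Mat n F) := by unfold Mat Matrix; infer_instance
  rw [setOf_isNonUnimodFreeCyc]
  refine ncard_eq_ncard_image_mul _ _ _ fun p hp => ?_
  rw [cyc_fibre hp, Set.InjOn.ncard_image]
  intro A hA B hB hAB
  obtain ⟨h1, h2⟩ := Prod.mk.inj hAB
  exact hp.2.2.2.eq_of_mul_eq hA.1 hB.1 h1 h2

end LowerTri

theorem ncard_lowerUnits (F : Type) [Field F] [Fintype F] :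
    (lowerUnits 3 F).ncard = (Fintype.card F - 1) ^ 3 * Fintype.card F ^ 3 := by
  classical
  let e : lowerUnits 3 F ≃ (Fˣ × Fˣ × Fˣ) × (F × F × F) :=
    { toFun := fun A => ((Units.mk0 _ (A.2.2 0), Units.mk0 _ (A.2.2 1), Units.mk0 _ (A.2.2 2)),
        (A.1 1 0, A.1 2 0, A.1 2 1))
      invFun := fun p => ⟨!![(p.1.1 : F), 0, 0; p.2.1, p.1.2.1, 0; p.2.2.1, p.2.2.2, p.1.2.2],
        by intro i j hij; fin_cases i <;> fin_cases j <;> first | rfl | simp at hij,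
        by intro i; fin_cases i <;> simp⟩
      left_inv := by
        rintro ⟨A, hA, hA'⟩
        ext i j
        fin_cases i <;> fin_cases j <;>
          first | rfl | exact (hA _ _ (by decide)).symm
      right_inv := by
        rintro ⟨⟨a, b, c⟩, d⟩
        simp }
  rw [← Nat.card_coe_set_eq, Nat.card_congr e, Nat.card_eq_fintype_card]
  simp only [Fintype.card_prod, Fintype.card_units]
  ring

/-! ### Rows of a pair -/

/-- The space containing the rows `(X i, Y i)` of a pair of `3 × 3` matrices. -/
abbrev RowSpace (F : Type) : Type := (Fin 3 → F) × (Fin 3 → F)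

theorem card_rowSpace {F : Type} [Fintype F] : Nat.card (RowSpace F) = Fintype.card F ^ 6 := by
  simp
  ring

section Rows

variable {F : Type} [Field F]

/-- The rows supported on the first `k` columns. -/
def rowFlag (F : Type) [Field F] (k : ℕ) : Submodule F (RowSpace F) where
  carrier := {w | ∀ j : Fin 3, k ≤ j → w.1 j = 0 ∧ w.2 j = 0}
  add_mem' := fun {a b} ha hb j hj => by simp [ha j hj, hb j hj]
  zero_mem' := fun j _ => by simp
  smul_mem' := fun c {a} ha j hj => by simp [ha j hj]

theorem mem_rowFlag {k : ℕ} {w : RowSpace F} :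
    w ∈ rowFlag F k ↔ ∀ j : Fin 3, k ≤ j → w.1 j = 0 ∧ w.2 j = 0 :=
  Iff.rfl

theorem rowFlag_mono {k l : ℕ} (h : k ≤ l) : rowFlag F k ≤ rowFlag F l :=
  fun _ hw j hj => hw j (h.trans hj)

theorem ncard_rowFlag_one [Fintype F] :
    (rowFlag F 1 : Set (RowSpace F)).ncard = Fintype.card F ^ 2 := by
  let e : rowFlag F 1 ≃ F × F :=
    { toFun := fun w => (w.1.1 0, w.1.2 0)
      invFun := fun p => ⟨(![p.1, 0, 0], ![p.2, 0, 0]), by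
        intro j hj; fin_cases j <;> simp at hj ⊢⟩
      left_inv := by
        rintro ⟨w, hw⟩
        have h1 := hw 1 le_rfl
        have h2 := hw 2 (by decide)
        ext j <;> fin_cases j <;> simp [h1, h2]
      right_inv := fun p => by simp }
  rw [← Nat.card_coe_set_eq]
  refine (Nat.card_congr e).trans ?_
  simp [sq]

theorem ncard_rowFlag_two [Fintype F] :
    (rowFlag F 2 : Set (RowSpace F)).ncard = Fintype.card F ^ 4 := by
  let e : rowFlag F 2 ≃ (F × F) × (F × F) :=
    { toFun := fun w => ((w.1.1 0, w.1.2 0), (w.1.1 1, w.1.2 1))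
      invFun := fun p => ⟨(![p.1.1, p.2.1, 0], ![p.1.2, p.2.2, 0]), by
        intro j hj; fin_cases j <;> simp at hj ⊢⟩
      left_inv := by
        rintro ⟨w, hw⟩
        have h2 := hw 2 le_rfl
        ext j <;> fin_cases j <;> simp [h2]
      right_inv := fun p => by simp }
  rw [← Nat.card_coe_set_eq]
  refine (Nat.card_congr e).trans ?_
  simp
  ring

theorem ncard_sdiff_submodule [Fintype F] {S T : Submodule F (RowSpace F)} (h : S ≤ T) :
    ((T : Set (RowSpace F)) \ S).ncard
      = (T : Set (RowSpace F)).ncard - (S : Set (RowSpace F)).ncard :=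
  Set.ncard_sdiff h

theorem ncard_span_range [Fintype F] {k : ℕ} {v : Fin k → RowSpace F}
    (hv : LinearIndependent F v) :
    (Submodule.span F (Set.range v) : Set (RowSpace F)).ncard = Fintype.card F ^ k := by
  rw [← Nat.card_coe_set_eq, ← Nat.card_eq_fintype_card]
  refine (Module.natCard_eq_pow_finrank (K := F)
    (V := Submodule.span F (Set.range v))).trans ?_
  rw [finrank_span_eq_card hv, Fintype.card_fin]

theorem linearIndependent_pair_iff {u v : RowSpace F} :
    LinearIndependent F ![u, v] ↔ u ≠ 0 ∧ v ∉ Submodule.span F {u} := by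
  rw [linearIndependent_finSucc']
  simp [Fin.init, Set.range_unique]

theorem linearIndependent_triple_iff {u v w : RowSpace F} :
    LinearIndependent F ![u, v, w] ↔
      LinearIndependent F ![u, v] ∧ w ∉ Submodule.span F (Set.range ![u, v]) := by
  rw [linearIndependent_finSucc']
  have : Fin.init ![u, v, w] = ![u, v] := by
    ext i : 1
    fin_cases i <;> rfl
  rw [this]
  rfl

theorem isFreePair_iff (X Y : Mat 3 F) :
    IsFreePair X Y ↔ LinearIndependent F fun i => ((X i, Y i) : RowSpace F) := by
  have key : ∀ g : Fin 3 → F, ∑ i, g i • ((X i, Y i) : RowSpace F) = (g ᵥ* X, g ᵥ* Y) := by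
    intro g
    ext j <;> simp [Matrix.vecMul, dotProduct, Fin.sum_univ_three]
  rw [Fintype.linearIndependent_iff]
  constructor
  · intro h g hg
    rw [key] at hg
    obtain ⟨h1, h2⟩ := Prod.mk.inj hg
    have := h (Matrix.of ![0, 0, g]) (fun i j hij => by
      fin_cases i <;> fin_cases j <;> simp at hij ⊢) (by
        ext i j
        fin_cases i
        · simp [Matrix.mul_apply]
        · simp [Matrix.mul_apply]
        · exact congrFun h1 j) (by
        ext i j
        fin_cases i
        · simp [Matrix.mul_apply]
        · simp [Matrix.mul_apply]
        · exact congrFun h2 j)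
    exact fun i => congrFun (congrFun this 2) i
  · intro h A _ hAX hAY
    ext i j
    refine h (A i) ?_ j
    rw [key]
    exact Prod.ext (congrFun hAX i) (congrFun hAY i)

/-- Row triples whose first two rows form a basis of the first stage of the flag. -/
def rowTriplesA (F : Type) [Field F] : Set ((RowSpace F × RowSpace F) × RowSpace F) :=
  {p | p.1 ∈ {r : RowSpace F × RowSpace F | r.1 ∈ (rowFlag F 1 : Set (RowSpace F)) \
      (⊥ : Submodule F (RowSpace F)) ∧
    r.2 ∈ (rowFlag F 1 : Set (RowSpace F)) \ Submodule.span F (Set.range ![r.1])} ∧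
    p.2 ∈ ((⊤ : Submodule F (RowSpace F)) : Set (RowSpace F)) \ rowFlag F 1}

/-- Independent row triples in the second stage of the flag, the first row lying in the first
stage and the second row outside it. -/
def rowTriplesB (F : Type) [Field F] : Set ((RowSpace F × RowSpace F) × RowSpace F) :=
  {p | p.1 ∈ {r : RowSpace F × RowSpace F | r.1 ∈ (rowFlag F 1 : Set (RowSpace F)) \
      (⊥ : Submodule F (RowSpace F)) ∧
    r.2 ∈ (rowFlag F 2 : Set (RowSpace F)) \ rowFlag F 1} ∧
    p.2 ∈ (rowFlag F 2 : Set (RowSpace F)) \ Submodule.span F (Set.range ![p.1.1, p.1.2])}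

theorem ncard_rowFlag_one_sdiff_bot [Fintype F] :
    ((rowFlag F 1 : Set (RowSpace F)) \ (⊥ : Submodule F (RowSpace F))).ncard
      = Fintype.card F ^ 2 - 1 := by
  rw [ncard_sdiff_submodule bot_le, ncard_rowFlag_one, Submodule.bot_coe, Set.ncard_singleton]

theorem linearIndependent_pair_of_notMem {u v : RowSpace F} (hu : u ∈ rowFlag F 1) (hu0 : u ≠ 0)
    (hv : v ∉ rowFlag F 1) : LinearIndependent F ![u, v] :=
  linearIndependent_pair_iff.2
    ⟨hu0, fun h => hv ((Submodule.span_singleton_le_iff_mem _ _).2 hu h)⟩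

theorem ncard_rowTriplesA [Fintype F] :
    (rowTriplesA F).ncard = (Fintype.card F ^ 2 - 1) * (Fintype.card F ^ 2 - Fintype.card F)
      * (Fintype.card F ^ 6 - Fintype.card F ^ 2) := by
  unfold rowTriplesA
  rw [ncard_fibred _ (fun _ => _) _ fun _ _ => rfl,
    ncard_fibred _ (fun r : RowSpace F =>
      (rowFlag F 1 : Set (RowSpace F)) \ Submodule.span F (Set.range ![r]))
      (Fintype.card F ^ 2 - Fintype.card F), ncard_rowFlag_one_sdiff_bot,
    ncard_sdiff_submodule le_top, ncard_rowFlag_one, Submodule.top_coe, Set.ncard_univ,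
    card_rowSpace]
  rintro r ⟨hr, hr0⟩
  have hli : LinearIndependent F ![r] := by
    rw [linearIndependent_unique_iff]
    exact hr0
  rw [ncard_sdiff_submodule, ncard_rowFlag_one, ncard_span_range hli, pow_one]
  rw [Submodule.span_le]
  rintro _ ⟨i, rfl⟩
  fin_cases i
  exact hr

theorem span_pair_le {u v : RowSpace F} {S : Submodule F (RowSpace F)} (hu : u ∈ S) (hv : v ∈ S) :
    Submodule.span F (Set.range ![u, v]) ≤ S := by
  rw [Submodule.span_le]
  rintro _ ⟨i, rfl⟩
  fin_cases i
  exacts [hu, hv]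

theorem ncard_rowTriplesB [Fintype F] :
    (rowTriplesB F).ncard = (Fintype.card F ^ 2 - 1) * (Fintype.card F ^ 4 - Fintype.card F ^ 2)
      * (Fintype.card F ^ 4 - Fintype.card F ^ 2) := by
  unfold rowTriplesB
  rw [ncard_fibred _ (fun r : RowSpace F × RowSpace F =>
      (rowFlag F 2 : Set (RowSpace F)) \ Submodule.span F (Set.range ![r.1, r.2]))
      (Fintype.card F ^ 4 - Fintype.card F ^ 2),
    ncard_fibred _ (fun _ => _) _ fun _ _ => rfl, ncard_rowFlag_one_sdiff_bot,
    ncard_sdiff_submodule (rowFlag_mono one_le_two), ncard_rowFlag_one, ncard_rowFlag_two]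
  rintro ⟨u, v⟩ ⟨⟨hu, hu0⟩, hv, hv'⟩
  rw [ncard_sdiff_submodule (span_pair_le (rowFlag_mono one_le_two hu) hv), ncard_rowFlag_two,
    ncard_span_range (linearIndependent_pair_of_notMem hu hu0 hv')]

theorem disjoint_rowTriples : Disjoint (rowTriplesA F) (rowTriplesB F) :=
  Set.disjoint_left.2 fun _ hA hB => hB.1.2.2 hA.1.2.1

theorem span_pair_eq_rowFlag_one [Fintype F] {u v : RowSpace F} (hu : u ∈ rowFlag F 1)
    (hv : v ∈ rowFlag F 1) (h : LinearIndependent F ![u, v]) :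
    Submodule.span F (Set.range ![u, v]) = rowFlag F 1 :=
  SetLike.coe_injective <| Set.eq_of_subset_of_ncard_le (span_pair_le hu hv)
    (by rw [ncard_rowFlag_one, ncard_span_range h])

theorem mem_rowTriples_iff [Fintype F] {u v w : RowSpace F} :
    ((u, v), w) ∈ rowTriplesA F ∪ rowTriplesB F ↔
      u ∈ rowFlag F 1 ∧ v ∈ rowFlag F 2 ∧ LinearIndependent F ![u, v, w] ∧
        (v ∈ rowFlag F 1 ∨ w ∈ rowFlag F 2) := by
  have hspan : Submodule.span F (Set.range ![u]) = Submodule.span F {u} := by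
    simp [Set.range_unique]
  constructor
  · rintro (⟨⟨⟨hu, hu0⟩, hv, hv'⟩, -, hw⟩ | ⟨⟨⟨hu, hu0⟩, hv, hv'⟩, hw, hw'⟩)
    · have hli : LinearIndependent F ![u, v] :=
        linearIndependent_pair_iff.2 ⟨hu0, hspan ▸ hv'⟩
      refine ⟨hu, rowFlag_mono one_le_two hv, linearIndependent_triple_iff.2 ⟨hli, ?_⟩, .inl hv⟩
      rwa [span_pair_eq_rowFlag_one hu hv hli]
    · exact ⟨hu, hv, linearIndependent_triple_iff.2
        ⟨linearIndependent_pair_of_notMem hu hu0 hv', hw'⟩, .inr hw⟩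
  · rintro ⟨hu, hv, hli, h⟩
    obtain ⟨hli, hw⟩ := linearIndependent_triple_iff.1 hli
    obtain ⟨hu0, hv0⟩ := linearIndependent_pair_iff.1 hli
    by_cases hv1 : v ∈ rowFlag F 1
    · refine .inl ⟨⟨⟨hu, hu0⟩, hv1, hspan ▸ hv0⟩, Submodule.mem_top, ?_⟩
      rwa [span_pair_eq_rowFlag_one hu hv1 hli] at hw
    · exact .inr ⟨⟨⟨hu, hu0⟩, hv, hv1⟩, h.resolve_left hv1, hw⟩

/-- A pair of matrices, viewed as its triple of rows. -/
def rowsEquiv (F : Type) : Mat 3 F × Mat 3 F ≃ (RowSpace F × RowSpace F) × RowSpace F where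
  toFun p := (((p.1 0, p.2 0), (p.1 1, p.2 1)), (p.1 2, p.2 2))
  invFun r := (Matrix.of ![r.1.1.1, r.1.2.1, r.2.1], Matrix.of ![r.1.1.2, r.1.2.2, r.2.2])
  left_inv p := by ext i j <;> fin_cases i <;> rfl
  right_inv _ := rfl

theorem lowerTri_iff_rows {X Y : Mat 3 F} :
    LowerTri X ∧ LowerTri Y ↔ (X 0, Y 0) ∈ rowFlag F 1 ∧ (X 1, Y 1) ∈ rowFlag F 2 := by
  simp only [LowerTri, mem_rowFlag, Fin.forall_fin_succ]
  simp
  tauto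

theorem not_unimodular_iff_rows {X Y : Mat 3 F} (hX : LowerTri X) (hY : LowerTri Y)
    (h0 : (X 0, Y 0) ≠ (0 : RowSpace F)) :
    ¬ Unimodular X Y ↔ (X 1, Y 1) ∈ rowFlag F 1 ∨ (X 2, Y 2) ∈ rowFlag F 2 := by
  have h00 : X 0 0 = 0 → Y 0 0 ≠ 0 := by
    refine fun hx hy => h0 (Prod.ext ?_ ?_)
    · ext j
      fin_cases j
      exacts [hx, hX 0 1 (by decide), hX 0 2 (by decide)]
    · ext j
      fin_cases j
      exacts [hy, hY 0 1 (by decide), hY 0 2 (by decide)]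
  have hX12 := hX 1 2 (by decide)
  have hY12 := hY 1 2 (by decide)
  simp [Unimodular, mem_rowFlag, Fin.forall_fin_succ, hX12, hY12]
  tauto

theorem rowsEquiv_image_nonUnimodFreePairs [Fintype F] :
    rowsEquiv F '' nonUnimodFreePairs 3 F = rowTriplesA F ∪ rowTriplesB F := by
  have key : ∀ p, p ∈ nonUnimodFreePairs 3 F ↔ rowsEquiv F p ∈ rowTriplesA F ∪ rowTriplesB F := by
    rintro ⟨X, Y⟩
    have hrows : (fun i => ((X i, Y i) : RowSpace F)) = ![(X 0, Y 0), (X 1, Y 1), (X 2, Y 2)] := by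
      ext i : 1
      fin_cases i <;> rfl
    refine Iff.trans ?_ mem_rowTriples_iff.symm
    rw [← hrows, ← isFreePair_iff, ← and_assoc, ← lowerTri_iff_rows]
    constructor
    · rintro ⟨hX, hY, hu, hf⟩
      refine ⟨⟨hX, hY⟩, hf, (not_unimodular_iff_rows hX hY ?_).1 hu⟩
      exact ((isFreePair_iff X Y).1 hf).ne_zero 0
    · rintro ⟨⟨hX, hY⟩, hf, hu⟩
      refine ⟨hX, hY, (not_unimodular_iff_rows hX hY ?_).2 hu, hf⟩
      exact ((isFreePair_iff X Y).1 hf).ne_zero 0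
  rw [Equiv.image_eq_preimage_symm]
  ext r
  simp [key]

end Rows

theorem stmt_13 (q : ℕ) (hq : 2 ≤ q)
    (F : Type) [Field F] [Fintype F] (hF : Fintype.card F = q) :
    Set.ncard {M : Set (Mat 3 F × Mat 3 F) | IsNonUnimodFreeCyc M}
      = (q + 1) ^ 2 * (2 * q ^ 2 + q + 1) := by
  have hcount := ncard_nonUnimodFreePairs (n := 3) (F := F)
  rw [← Set.ncard_image_of_injective _ (rowsEquiv F).injective,
    rowsEquiv_image_nonUnimodFreePairs, Set.ncard_union_eq disjoint_rowTriples,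
    ncard_rowTriplesA, ncard_rowTriplesB, ncard_lowerUnits, hF] at hcount
  obtain ⟨m, rfl⟩ : ∃ m, q = m + 1 := ⟨q - 1, by omega⟩
  have hm : 0 < m := by omega
  have e1 : (m + 1) ^ 2 - 1 = m * (m + 2) := Nat.sub_eq_of_eq_add (by ring)
  have e2 : (m + 1) ^ 2 - (m + 1) = m * (m + 1) := Nat.sub_eq_of_eq_add (by ring)
  have e3 : (m + 1) ^ 4 - (m + 1) ^ 2 = m * (m + 1) ^ 2 * (m + 2) :=
    Nat.sub_eq_of_eq_add (by ring)
  have e4 : (m + 1) ^ 6 - (m + 1) ^ 2 = m * (m + 1) ^ 2 * (m + 2) * ((m + 1) ^ 2 + 1) :=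
    Nat.sub_eq_of_eq_add (by ring)
  rw [e1, e2, e3, e4, Nat.add_sub_cancel] at hcount
  refine Nat.eq_of_mul_eq_mul_right (Nat.pos_of_ne_zero ?_) (hcount.symm.trans ?_)
  · positivity
  · ring
end
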